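/- Every path P_n is 0-rotatable: for each vertex v of P_n there exists a graceful labelling of P_n assigning 0 to v. -/

import Mathlib

/-- A graceful labelling of a graph `G` on a finite vertex type: `f` is an injection into
`{0, ..., |V| - 1}` and the induced edge labels `|f u - f v|` are pairwise distinct. -/
def IsGraceful {V : Type*} [Fintype V] (G : SimpleGraph V) (f : V → ℕ) : Prop :=
  Function.Injective f ∧ (∀ v, f v < Fintype.card V) ∧
    ∀ u v u' v', G.Adj u v → G.Adj u' v' →
      ((f u : ℤ) - (f v : ℤ)).natAbs = ((f u' : ℤ) - (f v' : ℤ)).natAbs →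
      s(u, v) = s(u', v')


/-- A graceful labelling of the path on `0, 1, ..., n - 1`, written as a sequence. -/
def IsGracefulSeq (n : ℕ) (g : ℕ → ℕ) : Prop :=
  (∀ i < n, g i < n) ∧ (∀ i < n, ∀ j < n, g i = g j → i = j) ∧
    ∀ i j, i + 1 < n → j + 1 < n →
      ((g i : ℤ) - g (i + 1)).natAbs = ((g j : ℤ) - g (j + 1)).natAbs → i = j

/-- A bipartite graceful labelling of the path on `2 * l` vertices: the vertex `i` has label `x i`
if `i` is even and `2 * l - 1 - x i` if `i` is odd, so that an edge has label `2 * l - 1` minus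
the sum of the values of `x` at its ends. -/
def IsAlphaSeq (l : ℕ) (x : ℕ → ℕ) : Prop :=
  (∀ i < 2 * l, x i < l) ∧ (∀ i < 2 * l, ∀ j < 2 * l, i % 2 = j % 2 → x i = x j → i = j) ∧
    ∀ i j, i + 1 < 2 * l → j + 1 < 2 * l → x i + x (i + 1) = x j + x (j + 1) → i = j

namespace IsAlphaSeq

variable {l t : ℕ} {x : ℕ → ℕ}

lemma flip (h : IsAlphaSeq l x) : IsAlphaSeq l (fun i => l - 1 - x i) := by
  obtain ⟨hlt, hinj, hsum⟩ := h
  refine ⟨fun i hi => ?_, fun i hi j hj hij e => ?_, fun i j hi hj e => ?_⟩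
  · have := hlt i hi
    dsimp only
    omega
  · have := hlt i hi
    have := hlt j hj
    exact hinj i hi j hj hij (by dsimp only at e; omega)
  · have := hlt i (by omega)
    have := hlt j (by omega)
    have := hlt (i + 1) hi
    have := hlt (j + 1) hj
    exact hsum i j hi hj (by dsimp only at e; omega)

/-- Prepend the zigzag `t, t, ..., 0, 0` to a bipartite labelling that starts with `t`. -/
lemma prepend (h : IsAlphaSeq l x) (h0 : x 0 = t) :
    IsAlphaSeq (l + t + 1)
      (fun i => if i < 2 * t + 2 then t - i / 2 else t + 1 + x (i - (2 * t + 2))) := by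
  obtain ⟨hlt, hinj, hsum⟩ := h
  refine ⟨fun i hi => ?_, fun i hi j hj hij e => ?_, fun i j hi hj e => ?_⟩
  · have := hlt (i - (2 * t + 2))
    dsimp only
    split_ifs <;> omega
  · dsimp only at e
    split_ifs at e
    · omega
    · omega
    · omega
    · have := hinj (i - (2 * t + 2)) (by omega) (j - (2 * t + 2)) (by omega) (by omega) (by omega)
      omega
  · generalize hf : (fun i => if i < 2 * t + 2 then t - i / 2 else t + 1 + x (i - (2 * t + 2))) = f
      at e
    have key : ∀ k, k + 1 < 2 * (l + t + 1) →
        (k < 2 * t + 1 ∧ f k + f (k + 1) = 2 * t - k) ∨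
        (k = 2 * t + 1 ∧ f k + f (k + 1) = 2 * t + 1) ∨
        (2 * t + 2 ≤ k ∧
          f k + f (k + 1) = 2 * t + 2 + (x (k - (2 * t + 2)) + x (k - (2 * t + 2) + 1))) := by
      intro k hk
      subst hf
      dsimp only
      rcases lt_trichotomy k (2 * t + 1) with h | h | h
      · rw [if_pos (show k < 2 * t + 2 by omega), if_pos (show k + 1 < 2 * t + 2 by omega)]
        omega
      · rw [if_pos (show k < 2 * t + 2 by omega), if_neg (show ¬k + 1 < 2 * t + 2 by omega),
          show k + 1 - (2 * t + 2) = 0 by omega, h0]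
        omega
      · rw [if_neg (show ¬k < 2 * t + 2 by omega), if_neg (show ¬k + 1 < 2 * t + 2 by omega),
          show k + 1 - (2 * t + 2) = k - (2 * t + 2) + 1 by omega]
        omega
    have := key i hi
    have := key j hj
    have := hsum (i - (2 * t + 2)) (j - (2 * t + 2))
    omega

/-- The bipartite labelling of the path on `4 * t + 2` vertices that starts with the middle
value `t`. -/
lemma middle (t : ℕ) :
    IsAlphaSeq (2 * t + 1)
      (fun i => if i < 2 * t + 1 then t - (i + 1) / 2 else 3 * t + 1 - (i + 1) / 2) := by
  refine ⟨fun i hi => ?_, fun i hi j hj hij e => ?_, fun i j hi hj e => ?_⟩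
  · dsimp only
    split_ifs <;> omega
  · dsimp only at e
    split_ifs at e <;> omega
  · dsimp only at e
    split_ifs at e <;> omega

lemma exists_start (l t : ℕ) (h : t < l) : ∃ x, IsAlphaSeq l x ∧ x 0 = t := by
  induction l using Nat.strong_induction_on generalizing t with
  | _ l ih =>
    have small : ∀ s, 2 * s + 2 ≤ l → ∃ x, IsAlphaSeq l x ∧ x 0 = s := by
      intro s hs
      obtain ⟨x, hx, h0⟩ := ih (l - s - 1) (by omega) s (by omega)
      refine ⟨_, (show l - s - 1 + s + 1 = l by omega) ▸ hx.prepend h0, ?_⟩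
      simp
    rcases lt_trichotomy (2 * t + 1) l with hl | rfl | hl
    · exact small t hl
    · exact ⟨_, middle t, by simp⟩
    · obtain ⟨x, hx, h0⟩ := small (l - 1 - t) (by omega)
      exact ⟨_, hx.flip, by omega⟩

lemma isGracefulSeq (h : IsAlphaSeq l x) :
    IsGracefulSeq (2 * l) (fun i => if i % 2 = 0 then x i else 2 * l - 1 - x i) := by
  obtain ⟨hlt, hinj, hsum⟩ := h
  refine ⟨fun i hi => ?_, fun i hi j hj e => ?_, fun i j hi hj e => ?_⟩
  · have := hlt i hi
    dsimp only
    split_ifs <;> omega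
  · have := hlt i hi
    have := hlt j hj
    have := hinj i hi j hj
    dsimp only at e
    split_ifs at e <;> omega
  · have := hlt i (by omega)
    have := hlt j (by omega)
    have := hlt (i + 1) hi
    have := hlt (j + 1) hj
    have := hsum i j hi hj
    dsimp only at e
    split_ifs at e <;> omega

/-- Prepend a zigzag on the labels `l, ..., l + 2 * t` to a bipartite labelling, whose two classes
are placed below and above these labels. -/
lemma prependInner (h : IsAlphaSeq l x) (h0 : x 0 = t) :
    IsGracefulSeq (2 * l + 2 * t + 1)
      (fun i => if i < 2 * t + 1 then (if i % 2 = 0 then l + i / 2 else l + 2 * t - i / 2)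
        else if i % 2 = 0 then l - 1 - x (i - (2 * t + 1))
        else l + 2 * t + 1 + x (i - (2 * t + 1))) := by
  obtain ⟨hlt, hinj, hsum⟩ := h
  refine ⟨fun i hi => ?_, fun i hi j hj e => ?_, fun i j hi hj e => ?_⟩
  · have := hlt (i - (2 * t + 1))
    dsimp only
    split_ifs <;> omega
  · have := hlt (i - (2 * t + 1))
    have := hlt (j - (2 * t + 1))
    have := hinj (i - (2 * t + 1))
    have := fun a b => this a (j - (2 * t + 1)) b
    dsimp only at e
    split_ifs at e <;> omega
  · generalize hf : (fun i => if i < 2 * t + 1 then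
        (if i % 2 = 0 then l + i / 2 else l + 2 * t - i / 2)
        else if i % 2 = 0 then l - 1 - x (i - (2 * t + 1))
        else l + 2 * t + 1 + x (i - (2 * t + 1))) = f at e
    have key : ∀ k, k + 1 < 2 * l + 2 * t + 1 →
        (k < 2 * t ∧ ((f k : ℤ) - f (k + 1)).natAbs = 2 * t - k) ∨
        (k = 2 * t ∧ ((f k : ℤ) - f (k + 1)).natAbs = 2 * t + 1) ∨
        (2 * t + 1 ≤ k ∧ ((f k : ℤ) - f (k + 1)).natAbs =
          2 * t + 2 + (x (k - (2 * t + 1)) + x (k - (2 * t + 1) + 1))) := by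
      intro k hk
      subst hf
      dsimp only
      rcases lt_trichotomy k (2 * t) with h | h | h
      · rw [if_pos (show k < 2 * t + 1 by omega), if_pos (show k + 1 < 2 * t + 1 by omega)]
        split_ifs <;> omega
      · rw [if_pos (show k < 2 * t + 1 by omega), if_neg (show ¬k + 1 < 2 * t + 1 by omega),
          show k + 1 - (2 * t + 1) = 0 by omega, h0]
        split_ifs <;> omega
      · rw [if_neg (show ¬k < 2 * t + 1 by omega), if_neg (show ¬k + 1 < 2 * t + 1 by omega),
          show k + 1 - (2 * t + 1) = k - (2 * t + 1) + 1 by omega]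
        have := hlt (k - (2 * t + 1)) (by omega)
        have := hlt (k - (2 * t + 1) + 1) (by omega)
        split_ifs <;> omega
    have := key i hi
    have := key j hj
    have := hsum (i - (2 * t + 1)) (j - (2 * t + 1))
    omega

end IsAlphaSeq

namespace IsGracefulSeq

variable {n t : ℕ} {g : ℕ → ℕ}

lemma compl (h : IsGracefulSeq n g) : IsGracefulSeq n (fun i => n - 1 - g i) := by
  obtain ⟨hlt, hinj, hdiff⟩ := h
  refine ⟨fun i hi => ?_, fun i hi j hj e => ?_, fun i j hi hj e => ?_⟩
  · dsimp only
    omega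
  · have := hlt i hi
    have := hlt j hj
    exact hinj i hi j hj (by dsimp only at e; omega)
  · have := hlt i (by omega)
    have := hlt j (by omega)
    have := hlt (i + 1) hi
    have := hlt (j + 1) hj
    exact hdiff i j hi hj (by dsimp only at e; omega)

lemma reverse (h : IsGracefulSeq n g) : IsGracefulSeq n (fun i => g (n - 1 - i)) := by
  obtain ⟨hlt, hinj, hdiff⟩ := h
  refine ⟨fun i hi => hlt _ (by omega), fun i hi j hj e => ?_, fun i j hi hj e => ?_⟩
  · have := hinj _ (by omega) _ (by omega) e
    omega
  · have := hdiff (n - 1 - (i + 1)) (n - 1 - (j + 1)) (by omega) (by omega) (by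
      rw [show n - 1 - (i + 1) + 1 = n - 1 - i by omega,
        show n - 1 - (j + 1) + 1 = n - 1 - j by omega]
      dsimp only at e
      omega)
    omega

/-- Prepend the zigzag `t, ..., n + 1, 0, n` on an odd number of vertices. -/
lemma prependOdd (h : IsGracefulSeq n g) (h0 : g 0 = t) :
    IsGracefulSeq (n + 2 * t + 1)
      (fun i => if i < 2 * t + 1 then (if i % 2 = 0 then t - i / 2 else n + t + 1 + i / 2)
        else t + n - g (i - (2 * t + 1))) := by
  obtain ⟨hlt, hinj, hdiff⟩ := h
  refine ⟨fun i hi => ?_, fun i hi j hj e => ?_, fun i j hi hj e => ?_⟩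
  · have := hlt (i - (2 * t + 1))
    dsimp only
    split_ifs <;> omega
  · have := hlt (i - (2 * t + 1))
    have := hlt (j - (2 * t + 1))
    have := hinj (i - (2 * t + 1))
    have := fun a b => this a (j - (2 * t + 1)) b
    dsimp only at e
    split_ifs at e <;> omega
  · generalize hf : (fun i => if i < 2 * t + 1 then
        (if i % 2 = 0 then t - i / 2 else n + t + 1 + i / 2)
        else t + n - g (i - (2 * t + 1))) = f at e
    have key : ∀ k, k + 1 < n + 2 * t + 1 →
        (k < 2 * t ∧ ((f k : ℤ) - f (k + 1)).natAbs = n + 1 + k) ∨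
        (k = 2 * t ∧ ((f k : ℤ) - f (k + 1)).natAbs = n) ∨
        (2 * t + 1 ≤ k ∧ ((f k : ℤ) - f (k + 1)).natAbs =
          ((g (k - (2 * t + 1)) : ℤ) - g (k - (2 * t + 1) + 1)).natAbs ∧
          ((f k : ℤ) - f (k + 1)).natAbs < n) := by
      intro k hk
      subst hf
      dsimp only
      rcases lt_trichotomy k (2 * t) with h | h | h
      · rw [if_pos (show k < 2 * t + 1 by omega), if_pos (show k + 1 < 2 * t + 1 by omega)]
        split_ifs <;> omega
      · rw [if_pos (show k < 2 * t + 1 by omega), if_neg (show ¬k + 1 < 2 * t + 1 by omega),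
          show k + 1 - (2 * t + 1) = 0 by omega, h0]
        split_ifs <;> omega
      · rw [if_neg (show ¬k < 2 * t + 1 by omega), if_neg (show ¬k + 1 < 2 * t + 1 by omega),
          show k + 1 - (2 * t + 1) = k - (2 * t + 1) + 1 by omega]
        have := hlt (k - (2 * t + 1)) (by omega)
        have := hlt (k - (2 * t + 1) + 1) (by omega)
        omega
    have := key i hi
    have := key j hj
    have := hdiff (i - (2 * t + 1)) (j - (2 * t + 1))
    omega

/-- Prepend the zigzag `t, ..., 0, n + 2 * t + 1` on an even number of vertices. -/
lemma prependEven (h : IsGracefulSeq n g) (h0 : g 0 = t) :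
    IsGracefulSeq (n + 2 * t + 2)
      (fun i => if i < 2 * t + 2 then (if i % 2 = 0 then t - i / 2 else n + t + 1 + i / 2)
        else t + 1 + g (i - (2 * t + 2))) := by
  obtain ⟨hlt, hinj, hdiff⟩ := h
  refine ⟨fun i hi => ?_, fun i hi j hj e => ?_, fun i j hi hj e => ?_⟩
  · have := hlt (i - (2 * t + 2))
    dsimp only
    split_ifs <;> omega
  · have := hlt (i - (2 * t + 2))
    have := hlt (j - (2 * t + 2))
    have := hinj (i - (2 * t + 2))
    have := fun a b => this a (j - (2 * t + 2)) b
    dsimp only at e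
    split_ifs at e <;> omega
  · generalize hf : (fun i => if i < 2 * t + 2 then
        (if i % 2 = 0 then t - i / 2 else n + t + 1 + i / 2)
        else t + 1 + g (i - (2 * t + 2))) = f at e
    have key : ∀ k, k + 1 < n + 2 * t + 2 →
        (k < 2 * t + 1 ∧ ((f k : ℤ) - f (k + 1)).natAbs = n + 1 + k) ∨
        (k = 2 * t + 1 ∧ ((f k : ℤ) - f (k + 1)).natAbs = n) ∨
        (2 * t + 2 ≤ k ∧ ((f k : ℤ) - f (k + 1)).natAbs =
          ((g (k - (2 * t + 2)) : ℤ) - g (k - (2 * t + 2) + 1)).natAbs ∧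
          ((f k : ℤ) - f (k + 1)).natAbs < n) := by
      intro k hk
      subst hf
      dsimp only
      rcases lt_trichotomy k (2 * t + 1) with h | h | h
      · rw [if_pos (show k < 2 * t + 2 by omega), if_pos (show k + 1 < 2 * t + 2 by omega)]
        split_ifs <;> omega
      · rw [if_pos (show k < 2 * t + 2 by omega), if_neg (show ¬k + 1 < 2 * t + 2 by omega),
          show k + 1 - (2 * t + 2) = 0 by omega, h0]
        split_ifs <;> omega
      · rw [if_neg (show ¬k < 2 * t + 2 by omega), if_neg (show ¬k + 1 < 2 * t + 2 by omega),
          show k + 1 - (2 * t + 2) = k - (2 * t + 2) + 1 by omega]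
        have := hlt (k - (2 * t + 2)) (by omega)
        have := hlt (k - (2 * t + 2) + 1) (by omega)
        omega
    have := key i hi
    have := key j hj
    have := hdiff (i - (2 * t + 2)) (j - (2 * t + 2))
    omega

lemma exists_start_even (l t : ℕ) (h : t < 2 * l) : ∃ g, IsGracefulSeq (2 * l) g ∧ g 0 = t := by
  rcases Nat.lt_or_ge t l with hl | hl
  · obtain ⟨x, hx, h0⟩ := IsAlphaSeq.exists_start l t hl
    exact ⟨_, hx.isGracefulSeq, by simpa using h0⟩
  · obtain ⟨x, hx, h0⟩ := IsAlphaSeq.exists_start l (2 * l - 1 - t) (by omega)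
    refine ⟨_, hx.isGracefulSeq.compl, ?_⟩
    simp only [Nat.zero_mod, if_true]
    omega

/-- Any label can occur at an end of a path. -/
lemma exists_start (n t : ℕ) (h : t < n) : ∃ g, IsGracefulSeq n g ∧ g 0 = t := by
  have small : ∀ s, 2 * s + 1 ≤ n → ∃ g, IsGracefulSeq n g ∧ g 0 = s := by
    intro s hs
    obtain ⟨l, rfl | rfl⟩ := Nat.even_or_odd' n
    · exact exists_start_even l s (by omega)
    rcases Nat.lt_or_ge l (2 * s) with hl | hl
    · obtain ⟨x, hx, h0⟩ := IsAlphaSeq.exists_start s (l - s) (by omega)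
      refine ⟨_, (show 2 * s + 2 * (l - s) + 1 = 2 * l + 1 by omega) ▸ hx.prependInner h0, ?_⟩
      simp
    · rcases Nat.eq_zero_or_pos l with rfl | hl0
      · exact ⟨fun _ => 0, by simp [IsGracefulSeq], by dsimp only; omega⟩
      · obtain ⟨g, hg, h0⟩ := exists_start_even (l - s) s (by omega)
        refine ⟨_, (show 2 * (l - s) + 2 * s + 1 = 2 * l + 1 by omega) ▸ hg.prependOdd h0, ?_⟩
        simp
  rcases Nat.lt_or_ge n (2 * t + 1) with hn | hn
  · obtain ⟨g, hg, h0⟩ := small (n - 1 - t) (by omega)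
    exact ⟨_, hg.compl, by omega⟩
  · exact small t hn

/-- The label `0` can occur at any vertex of a path. -/
lemma exists_zero (n k : ℕ) (h : k < n) : ∃ g, IsGracefulSeq n g ∧ g k = 0 := by
  have small : ∀ k, 2 * k + 1 ≤ n → ∃ g, IsGracefulSeq n g ∧ g k = 0 := by
    intro k hk
    rcases Nat.lt_or_ge n 2 with hn | hn
    · exact ⟨id, ⟨fun i hi => hi, fun i _ j _ e => e, fun i j hi hj _ => by omega⟩,
        by simp only [id]; omega⟩
    by_cases h5 : n = 5 ∧ k = 2
    · obtain ⟨rfl, rfl⟩ := h5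
      refine ⟨fun i => if i = 0 then 3 else if i = 1 then 2 else if i = 2 then 0
        else if i = 3 then 4 else 1, ⟨fun i hi => ?_, fun i hi j hj e => ?_,
          fun i j hi hj e => ?_⟩, by simp⟩
      · dsimp only
        split_ifs <;> omega
      · dsimp only at e
        split_ifs at e <;> omega
      · have hi : i < 4 := by omega
        have hj : j < 4 := by omega
        interval_cases i <;> interval_cases j <;> simp_all
    have start : ∃ g, IsGracefulSeq (n - 2 * (k / 2) - 2) g ∧ g 0 = k / 2 := by
      rcases Nat.lt_or_ge 2 n with hn2 | hn2
      · exact exists_start _ _ (by omega)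
      · have : n - 2 * (k / 2) - 2 = 0 := by omega
        rw [this]
        exact ⟨fun _ => k / 2, by simp [IsGracefulSeq], rfl⟩
    obtain ⟨g, hg, h0⟩ := start
    have hg' := hg.prependEven h0
    rw [show n - 2 * (k / 2) - 2 + 2 * (k / 2) + 2 = n by omega] at hg'
    rcases Nat.mod_two_eq_zero_or_one k with hk2 | hk2
    · refine ⟨_, hg', ?_⟩
      rw [if_pos (by omega), if_pos hk2]
      omega
    · refine ⟨_, hg'.compl, ?_⟩
      rw [if_pos (by omega), if_neg (by omega)]
      omega
  rcases Nat.lt_or_ge n (2 * k + 1) with hn | hn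
  · obtain ⟨g, hg, h0⟩ := small (n - 1 - k) (by omega)
    exact ⟨_, hg.reverse, h0⟩
  · exact small k hn

lemma isGraceful (h : IsGracefulSeq n g) :
    IsGraceful (SimpleGraph.pathGraph n) (fun v : Fin n => g v) := by
  obtain ⟨hlt, hinj, hdiff⟩ := h
  refine ⟨fun u v e => Fin.ext (hinj u u.2 v v.2 e), fun v => by simpa using hlt v v.2, ?_⟩
  intro u v u' v' huv huv' e
  rw [SimpleGraph.pathGraph_adj] at huv huv'
  dsimp only at e
  simp only [Sym2.eq_iff, Fin.ext_iff]
  rcases huv with h | h <;> rcases huv' with h' | h' <;> rw [← h, ← h'] at e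
  · have := hdiff u u' (by omega) (by omega) e
    omega
  · have := hdiff u v' (by omega) (by omega) (by omega)
    omega
  · have := hdiff v u' (by omega) (by omega) (by omega)
    omega
  · have := hdiff v v' (by omega) (by omega) (by omega)
    omega

end IsGracefulSeq

/-- Every path `P_n` is 0-rotatable: for each vertex there is a graceful labelling of
`P_n` assigning `0` to it (Rosa 1977). -/
theorem pathGraph_zeroRotatable (n : ℕ) :
    ∀ v : Fin n, ∃ f : Fin n → ℕ,
      IsGraceful (SimpleGraph.pathGraph n) f ∧ f v = 0 := by
  intro v
  obtain ⟨g, hg, h0⟩ := IsGracefulSeq.exists_zero n v v.2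
  exact ⟨_, hg.isGraceful, h0⟩
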